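/- Let X₀ ∈ ℝ^{m×n} have rank r, let Φ : ℝ^{m×n} → ℝᵖ be linear with ΦX₀ = b₀, and let t = min{m,n}. If Σ_{i=1}^r σᵢ(H) < Σ_{i=r+1}^t σᵢ(H) for every H ∈ Ker Φ \ {0} (where σ₁(H) ≥ ... ≥ σₜ(H) are singular values), then X₀ is a sharp minimizer of min{‖X‖_* : ΦX = b₀}. -/

import Mathlib

open Set Matrix
open scoped Classical

/-- The difference of two sublinear functions that is positive on a subspace minus the origin
dominates a multiple of the norm there. -/
theorem exists_pos_mul_norm_le_of_sublinear {V : Type*} [NormedAddCommGroup V] [NormedSpace ℝ V]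
    [FiniteDimensional ℝ V] (f g : V → ℝ)
    (hf_add : ∀ x y, f (x + y) ≤ f x + f y) (hf_smul : ∀ (c : ℝ) x, 0 ≤ c → f (c • x) = c * f x)
    (hg_add : ∀ x y, g (x + y) ≤ g x + g y) (hg_smul : ∀ (c : ℝ) x, 0 ≤ c → g (c • x) = c * g x)
    (K : Submodule ℝ V) (hpos : ∀ x ∈ K, x ≠ 0 → 0 < f x - g x) :
    ∃ κ > (0 : ℝ), ∀ x ∈ K, κ * ‖x‖ ≤ f x - g x := by
  have hcont : ∀ h : V → ℝ, (∀ x y, h (x + y) ≤ h x + h y) →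
      (∀ (c : ℝ) x, 0 ≤ c → h (c • x) = c * h x) → Continuous h := by
    intro h hadd hsmul
    have hconv : ConvexOn ℝ univ h := by
      refine ⟨convex_univ, fun x _ y _ a b ha hb _ => ?_⟩
      simpa [hsmul a x ha, hsmul b y hb] using hadd (a • x) (b • y)
    exact hconv.locallyLipschitz.continuous
  have hc : Continuous fun x => f x - g x := (hcont f hf_add hf_smul).sub (hcont g hg_add hg_smul)
  have hcomp : IsCompact (Metric.sphere (0 : V) 1 ∩ K) :=
    (isCompact_sphere 0 1).inter_right K.closed_of_finiteDimensional
  rcases (Metric.sphere (0 : V) 1 ∩ K).eq_empty_or_nonempty with hempty | hne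
  · refine ⟨1, one_pos, fun x hx => ?_⟩
    by_cases hx0 : x = 0
    · have h1 := hf_smul 0 0 le_rfl
      have h2 := hg_smul 0 0 le_rfl
      simp at h1 h2
      simp [hx0, h1, h2]
    · exfalso
      have : ‖x‖⁻¹ • x ∈ Metric.sphere (0 : V) 1 ∩ K :=
        ⟨by simp [norm_smul, hx0], K.smul_mem _ hx⟩
      simp [hempty] at this
  · obtain ⟨y, ⟨hy1, hyK⟩, hmin⟩ := hcomp.exists_isMinOn hne hc.continuousOn
    have hy0 : y ≠ 0 := by
      rintro rfl
      simp at hy1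
    refine ⟨f y - g y, hpos y hyK hy0, fun x hx => ?_⟩
    by_cases hx0 : x = 0
    · have h1 := hf_smul 0 0 le_rfl
      have h2 := hg_smul 0 0 le_rfl
      simp at h1 h2
      simp [hx0, h1, h2]
    · have hmem : ‖x‖⁻¹ • x ∈ Metric.sphere (0 : V) 1 ∩ K :=
        ⟨by simp [norm_smul, hx0], K.smul_mem _ hx⟩
      have hle : f y - g y ≤ f (‖x‖⁻¹ • x) - g (‖x‖⁻¹ • x) := hmin hmem
      have hx' : 0 < ‖x‖ := norm_pos_iff.2 hx0
      rw [hf_smul _ _ (inv_nonneg.2 hx'.le), hg_smul _ _ (inv_nonneg.2 hx'.le), ← mul_sub] at hle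
      calc (f y - g y) * ‖x‖ ≤ (‖x‖⁻¹ * (f x - g x)) * ‖x‖ := by gcongr
        _ = f x - g x := by field_simp

/-- A weighted sum of a nonnegative decreasing sequence, with weights in `[0, 1]` of total mass at
most `k`, is at most the sum of the first `k` terms. -/
theorem sum_mul_le_sum_first {t : ℕ} (k : ℕ) (h p : Fin t → ℝ) (h_nonneg : ∀ i, 0 ≤ h i)
    (h_anti : ∀ i j, i ≤ j → h j ≤ h i) (p_nonneg : ∀ i, 0 ≤ p i) (p_le : ∀ i, p i ≤ 1)
    (p_sum : ∑ i, p i ≤ k) :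
    ∑ i, h i * p i ≤ ∑ i : Fin t, if (i : ℕ) < k then h i else 0 := by
  by_cases hk : k < t
  · set c := h ⟨k, hk⟩ with hc
    have key : ∀ i : Fin t, (h i - c) * p i ≤ if (i : ℕ) < k then h i - c else 0 := by
      intro i
      split_ifs with hi
      · have : 0 ≤ h i - c := sub_nonneg.2 (h_anti i ⟨k, hk⟩ (Fin.le_def.2 hi.le))
        nlinarith [p_le i]
      · have : h i - c ≤ 0 := sub_nonpos.2 (h_anti ⟨k, hk⟩ i (Fin.le_def.2 (not_lt.1 hi)))
        nlinarith [p_nonneg i]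
    have hsum := Finset.sum_le_sum fun i (_ : i ∈ Finset.univ) => key i
    have hcard : (∑ i : Fin t, if (i : ℕ) < k then c else 0) = k * c := by
      have hfilter : (Finset.univ.filter fun i : Fin t => (i : ℕ) < k) = Finset.Iio ⟨k, hk⟩ := by
        ext i
        simp [Fin.lt_def]
      rw [← Finset.sum_filter, Finset.sum_const, hfilter]
      simp
    have hsplit : (∑ i : Fin t, if (i : ℕ) < k then h i - c else 0) =
        (∑ i : Fin t, if (i : ℕ) < k then h i else 0) -
          ∑ i : Fin t, if (i : ℕ) < k then c else 0 := by
      rw [← Finset.sum_sub_distrib]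
      refine Finset.sum_congr rfl fun i _ => ?_
      split_ifs <;> ring
    simp only [sub_mul, Finset.sum_sub_distrib, ← Finset.mul_sum] at hsum
    rw [hsplit, hcard] at hsum
    nlinarith [h_nonneg ⟨k, hk⟩]
  · refine Finset.sum_le_sum fun i _ => ?_
    rw [if_pos (lt_of_lt_of_le i.2 (not_lt.1 hk))]
    nlinarith [p_le i, h_nonneg i]

section Projections

variable {W : Type*} [NormedAddCommGroup W] [InnerProductSpace ℝ W] [FiniteDimensional ℝ W]

open Module

theorem Submodule.starProjection_apply_eq_add_of_le {K M : Submodule ℝ W} (hKM : K ≤ M) (x : W) :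
    M.starProjection x = K.starProjection x + (Kᗮ ⊓ M).starProjection x := by
  apply Submodule.eq_starProjection_of_mem_of_inner_eq_zero
  · exact M.add_mem (hKM (K.starProjection_apply_mem x))
      ((Kᗮ ⊓ M).starProjection_apply_mem x).2
  · intro y hy
    have h1 := K.starProjection_inner_eq_zero x _ (K.starProjection_apply_mem y)
    have hy2 : y - K.starProjection y ∈ Kᗮ ⊓ M :=
      ⟨K.sub_starProjection_mem_orthogonal y, M.sub_mem hy (hKM (K.starProjection_apply_mem y))⟩
    have h2 := (Kᗮ ⊓ M).starProjection_inner_eq_zero x _ hy2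
    have h3 := Submodule.inner_left_of_mem_orthogonal (K.starProjection_apply_mem y)
      ((Kᗮ ⊓ M).starProjection_apply_mem x).1
    have h4 := Submodule.inner_right_of_mem_orthogonal (K.starProjection_apply_mem x) hy2.1
    simp only [inner_sub_left, inner_sub_right, inner_add_left] at *
    linarith

theorem Orthonormal.sum_norm_sq_starProjection_le {ι : Type*} [Fintype ι] {e : ι → W}
    (he : Orthonormal ℝ e) (M : Submodule ℝ W) :
    ∑ i, ‖M.starProjection (e i)‖ ^ 2 ≤ finrank ℝ M := by
  have key : ∀ i, ‖M.starProjection (e i)‖ ^ 2 =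
      ∑ k, ‖inner ℝ (e i) (stdOrthonormalBasis ℝ M k : W)‖ ^ 2 := by
    intro i
    have h1 := (stdOrthonormalBasis ℝ M).sum_sq_norm_inner_right (M.orthogonalProjectionOnto (e i))
    rw [Submodule.starProjection_apply, Submodule.norm_coe, ← h1]
    refine Finset.sum_congr rfl fun k _ => ?_
    rw [Submodule.inner_orthogonalProjectionOnto_eq_of_mem_left, real_inner_comm]
  simp_rw [key]
  rw [Finset.sum_comm]
  calc _ ≤ ∑ k : Fin (finrank ℝ M), (1 : ℝ) := by
        refine Finset.sum_le_sum fun k _ => ?_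
        refine (he.sum_inner_products_le (s := Finset.univ) _).trans ?_
        have := (stdOrthonormalBasis ℝ M).orthonormal.1 k
        rw [Submodule.norm_coe, this]; norm_num
    _ = _ := by simp

end Projections

section Dilation

open Module

variable {m n t : ℕ}

/-- The trace of the compression to `M` of the symmetric dilation `[[0, H], [Hᵀ, 0]]` of `H`. -/
noncomputable def dilationTrace (M : Submodule ℝ (EuclideanSpace ℝ (Fin m ⊕ Fin n)))
    (H : Matrix (Fin m) (Fin n) ℝ) : ℝ :=
  2 * ∑ a, ∑ b, H a b * inner ℝ (EuclideanSpace.single (Sum.inl a) (1 : ℝ))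
    (M.starProjection (EuclideanSpace.single (Sum.inr b) 1))

theorem dilationTrace_add_right (M : Submodule ℝ (EuclideanSpace ℝ (Fin m ⊕ Fin n)))
    (H K : Matrix (Fin m) (Fin n) ℝ) :
    dilationTrace M (H + K) = dilationTrace M H + dilationTrace M K := by
  simp only [dilationTrace, Matrix.add_apply, add_mul, Finset.sum_add_distrib, mul_add]

theorem dilationTrace_smul_right (M : Submodule ℝ (EuclideanSpace ℝ (Fin m ⊕ Fin n)))
    (c : ℝ) (H : Matrix (Fin m) (Fin n) ℝ) :
    dilationTrace M (c • H) = c * dilationTrace M H := by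
  simp only [dilationTrace, Matrix.smul_apply, smul_eq_mul, mul_assoc, ← Finset.mul_sum]
  ring

theorem dilationTrace_eq_add_of_le {K M : Submodule ℝ (EuclideanSpace ℝ (Fin m ⊕ Fin n))}
    (hKM : K ≤ M) (H : Matrix (Fin m) (Fin n) ℝ) :
    dilationTrace M H = dilationTrace K H + dilationTrace (Kᗮ ⊓ M) H := by
  simp only [dilationTrace, Submodule.starProjection_apply_eq_add_of_le hKM, inner_add_right,
    mul_add, Finset.sum_add_distrib]

/-- `e i` and `f i` are orthonormal eigenvectors of the symmetric dilation of `H`, for the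
eigenvalues `h i` and `-h i`, and the dilation vanishes on their orthogonal complement; the
spectral decomposition is recorded through its traces. -/
structure IsDilationEigensystem (H : Matrix (Fin m) (Fin n) ℝ) (h : Fin t → ℝ)
    (e f : Fin t → EuclideanSpace ℝ (Fin m ⊕ Fin n)) : Prop where
  orthonormal_pos : Orthonormal ℝ e
  orthonormal_neg : Orthonormal ℝ f
  inner_eq_zero : ∀ i j, inner ℝ (e i) (f j) = 0
  dilationTrace_eq : ∀ M, dilationTrace M H =
    ∑ i, h i * (‖M.starProjection (e i)‖ ^ 2 - ‖M.starProjection (f i)‖ ^ 2)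

theorem exists_isDilationEigensystem (H : Matrix (Fin m) (Fin n) ℝ) (h : Fin t → ℝ)
    (u : Fin t → Fin m → ℝ) (v : Fin t → Fin n → ℝ)
    (hu : ∀ i j, u i ⬝ᵥ u j = if i = j then 1 else 0)
    (hv : ∀ i j, v i ⬝ᵥ v j = if i = j then 1 else 0)
    (hH : ∀ a b, H a b = ∑ i, h i * (u i a * v i b)) :
    ∃ e f, IsDilationEigensystem H h e f := by
  have hs : (√2)⁻¹ * (√2)⁻¹ = (2 : ℝ)⁻¹ := by
    rw [← mul_inv, Real.mul_self_sqrt (by norm_num)]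
  have hinner : ∀ i j (x y : ℝ),
      inner ℝ ((√2)⁻¹ • WithLp.toLp 2 (Sum.elim (u i) (x • v i)) :
        EuclideanSpace ℝ (Fin m ⊕ Fin n))
        ((√2)⁻¹ • WithLp.toLp 2 (Sum.elim (u j) (y • v j))) =
      if i = j then (1 + x * y) / 2 else 0 := by
    intro i j x y
    have h1 : inner ℝ (WithLp.toLp 2 (Sum.elim (u i) (x • v i)) :
        EuclideanSpace ℝ (Fin m ⊕ Fin n)) (WithLp.toLp 2 (Sum.elim (u j) (y • v j))) =
        u i ⬝ᵥ u j + x * y * (v i ⬝ᵥ v j) := by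
      simp only [PiLp.inner_apply, Fintype.sum_sum_type, Sum.elim_inl, Sum.elim_inr, dotProduct,
        Finset.mul_sum, Pi.smul_apply, smul_eq_mul, RCLike.inner_apply, conj_trivial]
      congr 1 <;> refine Finset.sum_congr rfl fun _ _ => by ring
    rw [inner_smul_left, inner_smul_right, h1, hu, hv, ← mul_assoc, conj_trivial, hs]
    split_ifs <;> ring
  refine ⟨fun i => (√2)⁻¹ • WithLp.toLp 2 (Sum.elim (u i) ((1 : ℝ) • v i)),
    fun i => (√2)⁻¹ • WithLp.toLp 2 (Sum.elim (u i) ((-1 : ℝ) • v i)), ?_, ?_, ?_, ?_⟩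
  · rw [orthonormal_iff_ite]
    intro i j
    rw [hinner]; norm_num
  · rw [orthonormal_iff_ite]
    intro i j
    rw [hinner]; norm_num
  · intro i j
    rw [hinner]; norm_num
  · intro M
    have hpair : ∀ i, ‖M.starProjection ((√2)⁻¹ • WithLp.toLp 2 (Sum.elim (u i) ((1 : ℝ) • v i)) :
          EuclideanSpace ℝ (Fin m ⊕ Fin n))‖ ^ 2 -
        ‖M.starProjection ((√2)⁻¹ • WithLp.toLp 2 (Sum.elim (u i) ((-1 : ℝ) • v i)) :
          EuclideanSpace ℝ (Fin m ⊕ Fin n))‖ ^ 2 =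
        2 * ∑ a, ∑ b, u i a * v i b * inner ℝ (EuclideanSpace.single (Sum.inl a) (1 : ℝ))
          (M.starProjection (EuclideanSpace.single (Sum.inr b) 1)) := by
      intro i
      set x : EuclideanSpace ℝ (Fin m ⊕ Fin n) :=
        ∑ a, u i a • EuclideanSpace.single (Sum.inl a) (1 : ℝ) with hx
      set y : EuclideanSpace ℝ (Fin m ⊕ Fin n) :=
        ∑ b, v i b • EuclideanSpace.single (Sum.inr b) (1 : ℝ) with hy
      have hxy : ∀ c : ℝ, (WithLp.toLp 2 (Sum.elim (u i) (c • v i)) :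
          EuclideanSpace ℝ (Fin m ⊕ Fin n)) = x + c • y := by
        intro c
        ext k
        rcases k with k | k <;> simp [hx, hy, Pi.single_apply]
      have hP : ∀ z, ‖M.starProjection z‖ ^ 2 = inner ℝ z (M.starProjection z) := by
        intro z
        have := M.re_inner_starProjection_eq_normSq (𝕜 := ℝ) z
        rw [real_inner_comm]
        simpa using this.symm
      have hsymm : inner ℝ y (M.starProjection x) = inner ℝ x (M.starProjection y) := by
        rw [← Submodule.inner_starProjection_left_eq_right, real_inner_comm]
      have hsum : ∑ a, ∑ b, u i a * v i b * inner ℝ (EuclideanSpace.single (Sum.inl a) (1 : ℝ))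
          (M.starProjection (EuclideanSpace.single (Sum.inr b) 1)) =
          inner ℝ x (M.starProjection y) := by
        simp only [hx, hy, map_sum, map_smul, sum_inner, inner_sum, inner_smul_left,
          inner_smul_right, conj_trivial, Finset.mul_sum]
        rw [Finset.sum_comm]
        refine Finset.sum_congr rfl fun _ _ => Finset.sum_congr rfl fun _ _ => by ring
      rw [hsum, hP, hP, hxy, hxy]
      simp only [map_smul, map_add, inner_smul_left, inner_smul_right, inner_add_left,
        inner_add_right, conj_trivial, hsymm]
      linear_combination (4 * inner ℝ x (M.starProjection y)) * hs
    simp only [hpair, dilationTrace, hH, Finset.sum_mul, Finset.mul_sum]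
    refine (Finset.sum_congr rfl fun a _ => Finset.sum_comm).trans ?_
    rw [Finset.sum_comm]
    refine Finset.sum_congr rfl fun _ _ => Finset.sum_congr rfl fun _ _ =>
      Finset.sum_congr rfl fun _ _ => by ring

theorem card_ne_zero_le_rank (H : Matrix (Fin m) (Fin n) ℝ) (h : Fin t → ℝ)
    (u : Fin t → Fin m → ℝ) (v : Fin t → Fin n → ℝ)
    (hu : ∀ i j, u i ⬝ᵥ u j = if i = j then 1 else 0)
    (hv : ∀ i j, v i ⬝ᵥ v j = if i = j then 1 else 0)
    (hH : ∀ a b, H a b = ∑ i, h i * (u i a * v i b)) :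
    Fintype.card {i // h i ≠ 0} ≤ H.rank := by
  have hlin : LinearIndependent ℝ u := by
    rw [Fintype.linearIndependent_iff]
    intro g hg i
    have := congrArg (fun w => u i ⬝ᵥ w) hg
    simpa [dotProduct_sum, dotProduct_smul, hu] using this
  have hmul : ∀ i, H *ᵥ v i = h i • u i := by
    intro i
    ext a
    have h1 : (H *ᵥ v i) a = ∑ j, h j * u j a * (v j ⬝ᵥ v i) := by
      simp only [mulVec, dotProduct, hH, Finset.sum_mul, Finset.mul_sum]
      rw [Finset.sum_comm]
      refine Finset.sum_congr rfl fun _ _ => Finset.sum_congr rfl fun _ _ => by ring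
    rw [h1]
    simp [hv]
  have hmem : ∀ i : {i // h i ≠ 0}, u i ∈ LinearMap.range H.mulVecLin := by
    rintro ⟨i, hi⟩
    refine ⟨(h i)⁻¹ • v i, ?_⟩
    simp [hmul, smul_smul, hi]
  have hlin' : LinearIndependent ℝ
      fun i : {i // h i ≠ 0} => (⟨u i, hmem i⟩ : LinearMap.range H.mulVecLin) := by
    apply LinearIndependent.of_comp (LinearMap.range H.mulVecLin).subtype
    exact hlin.comp _ Subtype.val_injective
  exact hlin'.fintype_card_le_finrank

namespace IsDilationEigensystem

variable {H : Matrix (Fin m) (Fin n) ℝ} {h : Fin t → ℝ}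
  {e f : Fin t → EuclideanSpace ℝ (Fin m ⊕ Fin n)}

theorem abs_dilationTrace_le (hE : IsDilationEigensystem H h e f) (h_nonneg : ∀ i, 0 ≤ h i)
    (h_anti : ∀ i j, i ≤ j → h j ≤ h i) (k : ℕ)
    (M : Submodule ℝ (EuclideanSpace ℝ (Fin m ⊕ Fin n))) (hM : finrank ℝ M ≤ k) :
    |dilationTrace M H| ≤ ∑ i : Fin t, if (i : ℕ) < k then h i else 0 := by
  have key : ∀ g : Fin t → EuclideanSpace ℝ (Fin m ⊕ Fin n), Orthonormal ℝ g →
      ∑ i, h i * ‖M.starProjection (g i)‖ ^ 2 ≤ ∑ i : Fin t, if (i : ℕ) < k then h i else 0 := by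
    intro g hg
    refine sum_mul_le_sum_first k h _ h_nonneg h_anti (fun i => sq_nonneg _) (fun i => ?_)
      ((hg.sum_norm_sq_starProjection_le M).trans (by exact_mod_cast hM))
    have := M.norm_starProjection_apply_le (g i)
    rw [hg.1 i] at this
    exact pow_le_one₀ (norm_nonneg _) this
  have hnn : ∀ g : Fin t → EuclideanSpace ℝ (Fin m ⊕ Fin n),
      0 ≤ ∑ i, h i * ‖M.starProjection (g i)‖ ^ 2 := fun g =>
    Finset.sum_nonneg fun i _ => mul_nonneg (h_nonneg i) (sq_nonneg _)
  rw [hE.dilationTrace_eq, abs_le]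
  simp only [mul_sub, Finset.sum_sub_distrib]
  constructor <;> linarith [key e hE.orthonormal_pos, key f hE.orthonormal_neg, hnn e, hnn f]

theorem dilationTrace_eq_sum (hE : IsDilationEigensystem H h e f)
    (M : Submodule ℝ (EuclideanSpace ℝ (Fin m ⊕ Fin n))) (s : Set (Fin t))
    (h_mem : ∀ i ∈ s, e i ∈ M) (h_orth : ∀ i ∈ s, f i ∈ Mᗮ)
    (h_zero : ∀ i ∉ s, h i = 0 ∨ (e i ∈ Mᗮ ∧ f i ∈ Mᗮ)) :
    dilationTrace M H = ∑ i, if i ∈ s then h i else 0 := by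
  rw [hE.dilationTrace_eq]
  refine Finset.sum_congr rfl fun i _ => ?_
  split_ifs with hi
  · rw [Submodule.starProjection_eq_self_iff.2 (h_mem i hi),
      (Submodule.starProjection_apply_eq_zero_iff M).2 (h_orth i hi), hE.orthonormal_pos.1 i]
    simp
  · rcases h_zero i hi with h0 | ⟨h1, h2⟩
    · simp [h0]
    · simp [(Submodule.starProjection_apply_eq_zero_iff M).2 h1,
        (Submodule.starProjection_apply_eq_zero_iff M).2 h2]

theorem dilationTrace_span (hE : IsDilationEigensystem H h e f) (s : Set (Fin t)) :
    dilationTrace (Submodule.span ℝ (e '' s)) H = ∑ i, if i ∈ s then h i else 0 := by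
  have horth : ∀ w, (∀ i ∈ s, inner ℝ (e i) w = 0) → w ∈ (Submodule.span ℝ (e '' s))ᗮ := by
    intro w hw
    rw [Submodule.mem_orthogonal]
    intro x hx
    induction hx using Submodule.span_induction with
    | mem x hx => obtain ⟨i, hi, rfl⟩ := hx; exact hw i hi
    | zero => simp
    | add x y _ _ hx hy => rw [inner_add_left, hx, hy, add_zero]
    | smul c x _ hx => rw [inner_smul_left, hx, mul_zero]
  refine hE.dilationTrace_eq_sum _ s (fun i hi => Submodule.subset_span ⟨i, hi, rfl⟩)
    (fun i _ => horth _ fun j _ => hE.inner_eq_zero j i) fun i hi => Or.inr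
      ⟨horth _ fun j hj => hE.orthonormal_pos.2 ?_, horth _ fun j _ => hE.inner_eq_zero j i⟩
  rintro rfl
  exact hi hj

end IsDilationEigensystem

theorem finrank_span_image_le_card {W : Type*} [AddCommGroup W] [Module ℝ W] (e : Fin t → W)
    (s : Set (Fin t)) [Fintype s] : finrank ℝ (Submodule.span ℝ (e '' s)) ≤ Fintype.card s := by
  rw [Set.image_eq_range]
  exact finrank_range_le_card _

/-- Lower bound for the growth of the nuclear norm at a matrix with at most `r` nonzero singular
values, in terms of the singular values of the increment. -/
theorem IsDilationEigensystem.exists_le_dilationTrace_add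
    {X H : Matrix (Fin m) (Fin n) ℝ} {x h : Fin t → ℝ}
    {e f e' f' : Fin t → EuclideanSpace ℝ (Fin m ⊕ Fin n)}
    (hX : IsDilationEigensystem X x e f) (hH : IsDilationEigensystem H h e' f')
    (h_nonneg : ∀ i, 0 ≤ h i) (h_anti : ∀ i j, i ≤ j → h j ≤ h i) (r : ℕ)
    (hr : Fintype.card {i // x i ≠ 0} ≤ r) :
    ∃ M, ∑ i, x i + (∑ i, h i - 2 * ∑ i : Fin t, if (i : ℕ) < r then h i else 0) ≤
      dilationTrace M (X + H) := by
  set s : Set (Fin t) := {i | x i ≠ 0}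
  set E := Submodule.span ℝ (e '' s)
  set F := Submodule.span ℝ (f '' s)
  set N := Submodule.span ℝ (e' '' univ)
  set N' := N ⊓ Fᗮ
  have hEr : finrank ℝ E ≤ r := (finrank_span_image_le_card e s).trans
    ((Fintype.card_congr (Equiv.refl _)).trans_le hr)
  have hFr : finrank ℝ F ≤ r := (finrank_span_image_le_card f s).trans
    ((Fintype.card_congr (Equiv.refl _)).trans_le hr)
  have hEF : E ≤ Fᗮ := by
    rw [← Submodule.isOrtho_iff_le, Submodule.isOrtho_span]
    rintro _ ⟨i, -, rfl⟩ _ ⟨j, -, rfl⟩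
    exact hX.inner_eq_zero i j
  have hMF : E ⊔ N' ≤ Fᗮ := sup_le hEF inf_le_right
  refine ⟨E ⊔ N', ?_⟩
  have hτX : dilationTrace (E ⊔ N') X = ∑ i, x i := by
    rw [hX.dilationTrace_eq_sum _ s]
    · refine Finset.sum_congr rfl fun i _ => ?_
      split_ifs with hi
      · rfl
      · exact (not_not.1 hi).symm
    · exact fun i hi => le_sup_left (a := E) (Submodule.subset_span ⟨i, hi, rfl⟩)
    · exact fun i hi => Submodule.orthogonal_le hMF
        (Submodule.le_orthogonal_orthogonal F (Submodule.subset_span ⟨i, hi, rfl⟩))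
    · exact fun i hi => Or.inl (not_not.1 hi)
  have hτN : dilationTrace N H = ∑ i, h i := by
    rw [hH.dilationTrace_span]
    simp
  have hMC := dilationTrace_eq_add_of_le (le_sup_right : N' ≤ E ⊔ N') H
  have hND := dilationTrace_eq_add_of_le (inf_le_left : N' ≤ N) H
  have hC : finrank ℝ (N'ᗮ ⊓ (E ⊔ N') : Submodule ℝ _) ≤ r := by
    have h1 := Submodule.finrank_add_inf_finrank_orthogonal (le_sup_right : N' ≤ E ⊔ N')
    have h2 := Submodule.finrank_add_le_finrank_add_finrank E N'
    omega
  have hD : finrank ℝ (N'ᗮ ⊓ N : Submodule ℝ _) ≤ r := by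
    have h1 : finrank ℝ N' + finrank ℝ (N'ᗮ ⊓ N : Submodule ℝ _) = finrank ℝ N :=
      Submodule.finrank_add_inf_finrank_orthogonal inf_le_left
    have h2 := Submodule.finrank_sup_add_finrank_inf_eq N Fᗮ
    have h3 := F.finrank_add_finrank_orthogonal
    have h4 := Submodule.finrank_le (N ⊔ Fᗮ)
    change _ + finrank ℝ N' = _ at h2
    omega
  have hC' := abs_le.1 (hH.abs_dilationTrace_le h_nonneg h_anti r _ hC)
  have hD' := abs_le.1 (hH.abs_dilationTrace_le h_nonneg h_anti r _ hD)
  rw [dilationTrace_add_right, hτX]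
  linarith [hC'.1, hD'.2]

theorem exists_vectors_of_svd (H : Matrix (Fin m) (Fin n) ℝ) (h : Fin (min m n) → ℝ)
    (U : Matrix (Fin m) (Fin m) ℝ) (V : Matrix (Fin n) (Fin n) ℝ)
    (hU : U * Uᵀ = 1) (hV : V * Vᵀ = 1)
    (hH : H = U * (Matrix.of fun (i : Fin m) (j : Fin n) =>
      if hij : (i : ℕ) = (j : ℕ) ∧ (i : ℕ) < min m n then h ⟨i, hij.2⟩ else 0) * Vᵀ) :
    ∃ (u : Fin (min m n) → Fin m → ℝ) (v : Fin (min m n) → Fin n → ℝ),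
      (∀ i j, u i ⬝ᵥ u j = if i = j then 1 else 0) ∧
      (∀ i j, v i ⬝ᵥ v j = if i = j then 1 else 0) ∧
      ∀ a b, H a b = ∑ i, h i * (u i a * v i b) := by
  refine ⟨fun i a => U a (Fin.castLE (min_le_left m n) i),
    fun i b => V b (Fin.castLE (min_le_right m n) i), fun i j => ?_, fun i j => ?_, fun a b => ?_⟩
  · have := congrArg (fun A => A (Fin.castLE (min_le_left m n) i)
      (Fin.castLE (min_le_left m n) j)) (mul_eq_one_comm.1 hU)
    simpa [Matrix.mul_apply, Matrix.one_apply, dotProduct] using this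
  · have := congrArg (fun A => A (Fin.castLE (min_le_right m n) i)
      (Fin.castLE (min_le_right m n) j)) (mul_eq_one_comm.1 hV)
    simpa [Matrix.mul_apply, Matrix.one_apply, dotProduct] using this
  · have hdiag : ∀ (k : Fin m) (l : Fin n),
        (if hij : (k : ℕ) = (l : ℕ) ∧ (k : ℕ) < min m n then h ⟨k, hij.2⟩ else 0) =
        ∑ i, if k = Fin.castLE (min_le_left m n) i then
          (if l = Fin.castLE (min_le_right m n) i then h i else 0) else 0 := by
      intro k l
      split_ifs with hkl
      · rw [Finset.sum_eq_single ⟨k, hkl.2⟩]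
        · exact ((if_pos (Fin.ext rfl)).trans (if_pos (Fin.ext hkl.1.symm))).symm
        · intro i _ hi
          rw [if_neg]
          rintro rfl
          exact hi rfl
        · simp
      · symm
        refine Finset.sum_eq_zero fun i _ => ?_
        split_ifs with h1 h2
        · exact absurd ⟨by simp [h1, h2], by rw [h1]; exact i.2⟩ hkl
        · rfl
        · rfl
    conv_lhs => rw [hH]
    simp only [Matrix.mul_apply, Matrix.of_apply, Matrix.transpose_apply, hdiag, Finset.mul_sum,
      Finset.sum_mul]
    rw [Finset.sum_comm]
    refine (Finset.sum_congr rfl fun k _ => Finset.sum_comm).trans ?_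
    rw [Finset.sum_comm]
    refine Finset.sum_congr rfl fun i _ => ?_
    simp [mul_comm, mul_left_comm]

end Dilation

/-- Let `X₀` have rank `r`, `Φ` linear with `ΦX₀ = b₀`, `t = min{m,n}`,
and let `σ H` denote the (decreasingly ordered, nonnegative) singular values of `H`
(characterized by an SVD `H = U diag(σ H) Vᵀ` with `U, V` orthogonal). If
`Σ_{i<r} σᵢ(H) < Σ_{r≤i<t} σᵢ(H)` for every `H ∈ Ker Φ \ {0}`, then `X₀` is a sharp
minimizer of `min {‖X‖_* : ΦX = b₀}` (in the Frobenius distance). -/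
theorem nuclear_norm_sharp_minimizer_of_singular_value_condition
    (m n p r : ℕ)
    (σ : Matrix (Fin m) (Fin n) ℝ → Fin (min m n) → ℝ)
    (hσ_nonneg : ∀ H i, 0 ≤ σ H i)
    (hσ_mono : ∀ H, ∀ i j : Fin (min m n), i ≤ j → σ H j ≤ σ H i)
    (hSVD : ∀ H : Matrix (Fin m) (Fin n) ℝ,
      ∃ U : Matrix (Fin m) (Fin m) ℝ, ∃ V : Matrix (Fin n) (Fin n) ℝ,
        U * Uᵀ = 1 ∧ V * Vᵀ = 1 ∧
        H = U * (Matrix.of fun (i : Fin m) (j : Fin n) =>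
          if h : (i : ℕ) = (j : ℕ) ∧ (i : ℕ) < min m n then σ H ⟨i, h.2⟩ else 0) * Vᵀ)
    (nuc : Matrix (Fin m) (Fin n) ℝ → ℝ) (hnuc : ∀ X, nuc X = ∑ i, σ X i)
    (frob : Matrix (Fin m) (Fin n) ℝ → ℝ)
    (hfrob : ∀ X, frob X = Real.sqrt (∑ i, ∑ j, (X i j) ^ 2))
    (Φ : Matrix (Fin m) (Fin n) ℝ →ₗ[ℝ] (Fin p → ℝ))
    (X₀ : Matrix (Fin m) (Fin n) ℝ) (hrank : X₀.rank = r)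
    (b₀ : Fin p → ℝ) (hfeas : Φ X₀ = b₀)
    (hker : ∀ H : Matrix (Fin m) (Fin n) ℝ, Φ H = 0 → H ≠ 0 →
      (∑ i : Fin (min m n), if (i : ℕ) < r then σ H i else 0) <
      (∑ i : Fin (min m n), if r ≤ (i : ℕ) then σ H i else 0)) :
    ∃ κ > (0 : ℝ), ∃ δ > (0 : ℝ), ∀ X : Matrix (Fin m) (Fin n) ℝ,
      Φ X = b₀ → frob (X - X₀) ≤ δ → κ * frob (X - X₀) ≤ nuc X - nuc X₀ := by
  have hvec : ∀ H : Matrix (Fin m) (Fin n) ℝ,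
      ∃ (u : Fin (min m n) → Fin m → ℝ) (v : Fin (min m n) → Fin n → ℝ),
        (∀ i j, u i ⬝ᵥ u j = if i = j then 1 else 0) ∧
        (∀ i j, v i ⬝ᵥ v j = if i = j then 1 else 0) ∧
        ∀ a b, H a b = ∑ i, σ H i * (u i a * v i b) := fun H => by
    obtain ⟨U, V, hU, hV, hH⟩ := hSVD H
    exact exists_vectors_of_svd H (σ H) U V hU hV hH
  have hsys : ∀ H, ∃ e f, IsDilationEigensystem H (σ H) e f := fun H => by
    obtain ⟨u, v, hu, hv, hH⟩ := hvec H
    exact exists_isDilationEigensystem H (σ H) u v hu hv hH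
  have hcard : Fintype.card {i // σ X₀ i ≠ 0} ≤ r := by
    obtain ⟨u, v, hu, hv, hH⟩ := hvec X₀
    exact hrank ▸ card_ne_zero_le_rank X₀ (σ X₀) u v hu hv hH
  let head : ℕ → Matrix (Fin m) (Fin n) ℝ → ℝ :=
    fun k H => ∑ i : Fin (min m n), if (i : ℕ) < k then σ H i else 0
  have hle : ∀ k H (M : Submodule ℝ (EuclideanSpace ℝ (Fin m ⊕ Fin n))),
      Module.finrank ℝ M ≤ k → dilationTrace M H ≤ head k H := by
    intro k H M hM
    obtain ⟨e, f, hE⟩ := hsys H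
    exact (le_abs_self _).trans (hE.abs_dilationTrace_le (hσ_nonneg H) (hσ_mono H) k M hM)
  have hex : ∀ k H, ∃ M : Submodule ℝ (EuclideanSpace ℝ (Fin m ⊕ Fin n)),
      Module.finrank ℝ M ≤ k ∧ dilationTrace M H = head k H := by
    intro k H
    obtain ⟨e, f, hE⟩ := hsys H
    refine ⟨_, (finrank_span_image_le_card e {i | (i : ℕ) < k}).trans ?_,
      (hE.dilationTrace_span _).trans ?_⟩
    · simpa using Fintype.card_le_of_injective
        (fun i : {i : Fin (min m n) | (i : ℕ) < k} => (⟨i.1, i.2⟩ : Fin k))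
        fun i j hij => Subtype.ext (Fin.ext (by simpa using hij))
    · refine Finset.sum_congr rfl fun i _ => ?_
      congr
  have hadd : ∀ k H K, head k (H + K) ≤ head k H + head k K := by
    intro k H K
    obtain ⟨M, hM, h⟩ := hex k (H + K)
    rw [← h, dilationTrace_add_right]
    exact add_le_add (hle k H M hM) (hle k K M hM)
  have hsmul_le : ∀ k (c : ℝ) H, 0 ≤ c → head k (c • H) ≤ c * head k H := by
    intro k c H hc
    obtain ⟨M, hM, h⟩ := hex k (c • H)
    rw [← h, dilationTrace_smul_right]
    exact mul_le_mul_of_nonneg_left (hle k H M hM) hc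
  have hsmul : ∀ k (c : ℝ) H, 0 ≤ c → head k (c • H) = c * head k H := by
    intro k c H hc
    refine (hsmul_le k c H hc).antisymm ?_
    obtain ⟨M, hM, h⟩ := hex k H
    rw [← h, ← dilationTrace_smul_right]
    exact hle k _ M hM
  have hnuc_head : ∀ H, nuc H = head (m + n) H := by
    intro H
    rw [hnuc]
    refine Finset.sum_congr rfl fun i _ => (if_pos ?_).symm
    omega
  have htail : ∀ H, nuc H - 2 * head r H =
      (∑ i : Fin (min m n), if r ≤ (i : ℕ) then σ H i else 0) - head r H := by
    intro H
    have : nuc H = head r H + ∑ i : Fin (min m n), if r ≤ (i : ℕ) then σ H i else 0 := by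
      rw [hnuc, ← Finset.sum_add_distrib]
      refine Finset.sum_congr rfl fun i _ => ?_
      by_cases hi : (i : ℕ) < r
      · simp [hi, not_le.2 hi]
      · simp [hi, not_lt.1 hi]
    linarith
  let : NormedAddCommGroup (Matrix (Fin m) (Fin n) ℝ) := Matrix.frobeniusNormedAddCommGroup
  let : NormedSpace ℝ (Matrix (Fin m) (Fin n) ℝ) := Matrix.frobeniusNormedSpace
  have hnorm : ∀ H : Matrix (Fin m) (Fin n) ℝ, frob H = ‖H‖ := by
    intro H
    rw [hfrob, Matrix.frobenius_norm_def, Real.sqrt_eq_rpow]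
    simp
  obtain ⟨κ, hκ, hbound⟩ := exists_pos_mul_norm_le_of_sublinear nuc (fun H => 2 * head r H)
    (fun H K => by simpa only [hnuc_head] using hadd _ H K)
    (fun c H hc => by simpa only [hnuc_head] using hsmul _ c H hc)
    (fun H K => by linarith [hadd r H K])
    (fun c H hc => by rw [hsmul r c H hc]; ring) (LinearMap.ker Φ)
    (fun H hH hH0 => by
      rw [htail]
      exact sub_pos.2 (hker H hH hH0))
  refine ⟨κ, hκ, 1, one_pos, fun X hX _ => ?_⟩
  have hmem : X - X₀ ∈ LinearMap.ker Φ := by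
    rw [LinearMap.mem_ker, map_sub, hX, hfeas, sub_self]
  obtain ⟨e, f, hE⟩ := hsys X₀
  obtain ⟨e', f', hE'⟩ := hsys (X - X₀)
  obtain ⟨M, hM⟩ := hE.exists_le_dilationTrace_add hE' (hσ_nonneg _) (hσ_mono _) r hcard
  have hM' := hle (m + n) (X₀ + (X - X₀)) M (by simpa using Submodule.finrank_le M)
  rw [← hnuc_head, add_sub_cancel] at hM'
  rw [add_sub_cancel, ← hnuc, ← hnuc] at hM
  rw [hnorm]
  linarith [hbound _ hmem]
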